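/- arXiv:1606.03348 — 2 statements merged into one kernel-verified Lean document; each statement's English description precedes it below -/
import Mathlib

section
/- Let c > 1 be a real number. Then ∫₀¹ (1−t)^c [ ∫₀^{c/(1−t)} (1 + x(1−t)) dx + ∫_c^{c/(1−t)} (x − c − c·ln(x/c)) dx ] dt = 1 + c/2 + 1/(c²−1). (This is the expected rank of the memoryless threshold rule with threshold function f(t) = c/(1−t) in the planar Poisson embedding of Robbins' problem.) -/
open MeasureTheory intervalIntegral Real

/-- The integral of the penalty `x - c - c * log (x / c)` from `c` to `T`. -/
lemma integral_sub_sub_mul_log_div {c T : ℝ} (hc : 0 < c) (hT : c ≤ T) :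
    ∫ x in c..T, (x - c - c * Real.log (x / c)) =
      (T ^ 2 - c ^ 2) / 2 - c * T * Real.log (T / c) := by
  have hpos : ∀ x ∈ Set.uIcc c T, 0 < x := fun x hx => by
    rw [Set.uIcc_of_le hT] at hx
    exact hc.trans_le hx.1
  have hderiv : ∀ x ∈ Set.uIcc c T,
      HasDerivAt (fun x => x ^ 2 / 2 - c * (x * Real.log (x / c)))
        (x - c - c * Real.log (x / c)) x := fun x hx => by
    have hx0 := hpos x hx
    have h1 : HasDerivAt (fun x => Real.log (x / c)) ((1 / c) / (x / c)) x :=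
      ((hasDerivAt_id x).div_const c).log (by positivity)
    have h2 := (((hasDerivAt_id x).pow 2).div_const 2).sub
      (((hasDerivAt_id x).mul h1).const_mul c)
    refine (h2.congr_deriv ?_)
    simp only [id]
    field_simp
    ring
  rw [integral_eq_sub_of_hasDerivAt hderiv]
  · simp only [div_self hc.ne', Real.log_one]
    ring
  · refine ContinuousOn.intervalIntegrable ?_
    refine (by fun_prop : ContinuousOn (fun x : ℝ => x - c) _).sub
      (continuousOn_const.mul (ContinuousOn.log (by fun_prop) fun x hx => ?_))
    have := hpos x hx
    positivity

lemma integral_sub_sub_mul_log_div_nonneg {c T : ℝ} (hc : 0 < c) (hT : c ≤ T) :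
    0 ≤ ∫ x in c..T, (x - c - c * Real.log (x / c)) := by
  refine integral_nonneg hT fun x hx => ?_
  have hx0 : 0 < x := hc.trans_le hx.1
  have h := mul_le_mul_of_nonneg_left (Real.log_le_sub_one_of_pos (div_pos hx0 hc)) hc.le
  have h' : c * (x / c - 1) = x - c := by field_simp
  linarith

lemma integral_one_add_mul (T s : ℝ) :
    ∫ x in (0:ℝ)..T, (1 + x * s) = T + T ^ 2 / 2 * s := by
  rw [intervalIntegral.integral_add (by simp) (Continuous.intervalIntegrable (by fun_prop) _ _),
    intervalIntegral.integral_mul_const, integral_id]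
  simp

/-- The expected rank of the memoryless threshold rule with threshold function
`f t = c / (1 - t)` in the planar Poisson embedding of Robbins' problem equals
`1 + c/2 + 1/(c² - 1)`. -/
theorem expected_rank_threshold_rule (c : ℝ) (hc : 1 < c) :
    (∫ t in (0:ℝ)..1, (1 - t) ^ c *
      ((∫ x in (0:ℝ)..(c / (1 - t)), (1 + x * (1 - t))) +
       (∫ x in c..(c / (1 - t)), (x - c - c * Real.log (x / c))))) =
    1 + c / 2 + 1 / (c ^ 2 - 1) := by
  have hc0 : 0 < c := by linarith
  have hc1 : 0 < c - 1 := by linarith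
  let g : ℝ → ℝ := fun s => s ^ c *
      ((∫ x in (0:ℝ)..(c / s), (1 + x * s)) +
       (∫ x in c..(c / s), (x - c - c * Real.log (x / c))))
  let F : ℝ → ℝ := fun s => (1 + c / 2) * s ^ c + c ^ 2 / (2 * (c - 1)) * s ^ (c - 1)
    - c ^ 2 / (2 * (c + 1)) * s ^ (c + 1) + (c * (s ^ (c - 1) * (s * Real.log s)) - s ^ c)
  have hcont : ContinuousOn F (Set.Icc 0 1) := by
    have hp : ∀ p : ℝ, 0 ≤ p → Continuous fun s : ℝ => s ^ p :=
      fun p hp => Real.continuous_rpow_const hp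
    have h1 := hp c hc0.le
    have h2 := hp (c - 1) hc1.le
    have h3 := hp (c + 1) (by linarith)
    have h4 := Real.continuous_mul_log
    exact Continuous.continuousOn (by fun_prop)
  have hle : ∀ s ∈ Set.Ioo (0:ℝ) 1, c ≤ c / s := fun s hs => by
    rw [le_div_iff₀ hs.1]
    nlinarith [hs.2]
  have hderiv : ∀ s ∈ Set.Ioo (0:ℝ) 1, HasDerivAt F (g s) s := fun s hs => by
    have hs0 : 0 < s := hs.1
    have hp : ∀ p : ℝ, HasDerivAt (fun s : ℝ => s ^ p) (p * s ^ (p - 1)) s :=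
      fun p => Real.hasDerivAt_rpow_const (Or.inl hs0.ne')
    have h := ((((hp c).const_mul (1 + c / 2)).add
      ((hp (c - 1)).const_mul (c ^ 2 / (2 * (c - 1))))).sub
      ((hp (c + 1)).const_mul (c ^ 2 / (2 * (c + 1))))).add
      ((((hp (c - 1)).mul (Real.hasDerivAt_mul_log hs0.ne')).const_mul c).sub (hp c))
    refine h.congr_deriv ?_
    simp only [g]
    rw [integral_one_add_mul, integral_sub_sub_mul_log_div hc0 (hle s hs)]
    have hlog : Real.log (c / s / c) = -Real.log s := by
      rw [← Real.log_inv]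
      congr 1
      field_simp
    rw [hlog, Real.rpow_sub_one hs0.ne' (c - 1), Real.rpow_sub_one hs0.ne' c,
      add_sub_cancel_right]
    have : c + 1 ≠ 0 := by positivity
    field_simp
    ring
  have hnonneg : ∀ s ∈ Set.Ioo (0:ℝ) 1, 0 ≤ g s := fun s hs => by
    have hs0 : 0 < s := hs.1
    have h := integral_sub_sub_mul_log_div_nonneg hc0 (hle s hs)
    simp only [g]
    rw [integral_one_add_mul]
    positivity
  have hint : IntervalIntegrable g volume 0 1 :=
    (intervalIntegrable_iff_integrableOn_Ioc_of_le zero_le_one).2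
      (integrableOn_deriv_of_nonneg hcont hderiv hnonneg)
  have hsubst := intervalIntegral.integral_comp_sub_left g (a := 0) (b := 1) 1
  simp only [sub_self, sub_zero] at hsubst
  refine hsubst.trans ?_
  rw [integral_eq_sub_of_hasDerivAt_of_le zero_le_one hcont hderiv hint]
  have h2 : c ^ 2 - 1 ≠ 0 := by nlinarith
  have h3 : c + 1 ≠ 0 := by positivity
  simp only [F, Real.one_rpow, Real.log_one, Real.zero_rpow hc0.ne', Real.zero_rpow hc1.ne',
    Real.zero_rpow h3]
  have h4 : c - 1 ≠ 0 := hc1.ne'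
  field_simp
  ring
end

section
/- For every real number c > 1, 1 + c/2 + 1/(c²−1) ≥ 2.3318. -/
/-- For every `c > 1`, the expected rank `1 + c/2 + 1/(c² - 1)` of the
memoryless threshold rule with threshold function `f t = c/(1-t)` is at least
`2.3318`. -/
theorem threshold_rule_value_ge (c : ℝ) (hc : 1 < c) :
    1 + c / 2 + 1 / (c ^ 2 - 1) ≥ 2.3318 := by
  have hpos : 0 < c ^ 2 - 1 := by nlinarith
  have hcubic : 0 ≤ (c / 2 - 1.3318) * (c ^ 2 - 1) + 1 := by
    have hsq : 0 ≤ (c - 1.94695) ^ 2 * (c / 2 + 0.61515) := by positivity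
    linarith
  have hdiv : 1.3318 - c / 2 ≤ 1 / (c ^ 2 - 1) := by
    rw [le_div_iff₀ hpos]
    linarith
  linarith
end
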